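/- arXiv:2603.24087 — 3 statements merged into one kernel-verified Lean document; each statement's English description precedes it below -/
import Mathlib

section
/- Let m ≥ 1, N ≥ 1 be integers, p > 1, C₀ > 0, ν₀ > 0, L ≥ 0 be reals. Let A : ℝᵐ → ℝ be differentiable with |∂_{s_i}A(s)| ≤ C₀ for every i = 1,…,m and every s ∈ ℝᵐ, and A(s) ≥ ν₀ for every s ∈ ℝᵐ. Let ψ : ℝ → ℝ be differentiable with |ψ'(t)| ≤ L and ψ'(t) ≥ (C₀ m/(ν₀ p)) e^{2L} for every t ∈ ℝ. Then for every choice of signs σ₁,…,σ_m ∈ {−1,1}, every s, s' ∈ ℝᵐ with ‖s − s'‖ ≤ 1 (Euclidean norm), and every ξ₁,…,ξ_m ∈ ℝᴺ, one has ∑_{j=1}^m { ∑_{i=1}^m (σ_i/p) ∂_{s_i}A(s) e^{σ_i ψ(s'_i) − σ_i ψ(s_i)} − A(s) ψ'(s_j) e^{σ_j ψ(s'_j) − σ_j ψ(s_j)} } ‖ξ_j‖² ≤ 0. -/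
open Real

/-- A differentiable real function whose derivative is bounded by `L` varies by at most `L`
between points at distance at most `1`. -/
lemma abs_sub_le_of_abs_deriv_le {ψ : ℝ → ℝ} {L : ℝ} (hL : 0 ≤ L) (hψ : Differentiable ℝ ψ)
    (hψL : ∀ t, |deriv ψ t| ≤ L) {x y : ℝ} (hxy : |x - y| ≤ 1) : |ψ y - ψ x| ≤ L := by
  have h := Convex.norm_image_sub_le_of_norm_deriv_le (f := ψ) (s := Set.univ) (C := L)
    (fun t _ => hψ t) (fun t _ => hψL t) convex_univ (Set.mem_univ x) (Set.mem_univ y)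
  rw [Real.norm_eq_abs, Real.norm_eq_abs, abs_sub_comm y x] at h
  exact h.trans (mul_le_of_le_one_right hL hxy)

/-- The paper's sufficient criterion for the structural hypothesis (ψ) in the vectorial case:
if `|∂_{s_i} A| ≤ C₀`, `A ≥ ν₀`, `ψ` is differentiable with `|ψ'| ≤ L` and
`ψ' ≥ (C₀ m/(ν₀ p)) e^{2L}`, then for all signs `σᵢ ∈ {-1,1}`, all `s, s'` with `‖s - s'‖ ≤ 1`
and all `ξ₁,…,ξ_m ∈ ℝᴺ`, the quantity
`∑_j { ∑_i (σᵢ/p) ∂_{s_i}A(s) e^{σᵢψ(s'ᵢ)-σᵢψ(sᵢ)} - A(s) ψ'(s_j) e^{σⱼψ(s'ⱼ)-σⱼψ(sⱼ)} } ‖ξⱼ‖²`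
is nonpositive. -/
theorem vectorial_psi_criterion (m N : ℕ) (hm : 1 ≤ m) (hN : 1 ≤ N)
    (p C₀ ν₀ L : ℝ) (hp : 1 < p) (hC₀ : 0 < C₀) (hν₀ : 0 < ν₀) (hL : 0 ≤ L)
    (A : EuclideanSpace ℝ (Fin m) → ℝ) (hA : Differentiable ℝ A)
    (hA' : ∀ (i : Fin m) (s : EuclideanSpace ℝ (Fin m)),
      |fderiv ℝ A s (EuclideanSpace.single i 1)| ≤ C₀)
    (hAν : ∀ s : EuclideanSpace ℝ (Fin m), ν₀ ≤ A s)
    (ψ : ℝ → ℝ) (hψ : Differentiable ℝ ψ)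
    (hψL : ∀ t : ℝ, |deriv ψ t| ≤ L)
    (hψlow : ∀ t : ℝ, C₀ * m / (ν₀ * p) * Real.exp (2 * L) ≤ deriv ψ t)
    (σ : Fin m → ℝ) (hσ : ∀ i, σ i = 1 ∨ σ i = -1)
    (s s' : EuclideanSpace ℝ (Fin m)) (hss' : ‖s - s'‖ ≤ 1)
    (ξ : Fin m → EuclideanSpace ℝ (Fin N)) :
    ∑ j : Fin m,
      ((∑ i : Fin m, σ i / p * fderiv ℝ A s (EuclideanSpace.single i 1) *
          Real.exp (σ i * ψ (s' i) - σ i * ψ (s i)))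
        - A s * deriv ψ (s j) * Real.exp (σ j * ψ (s' j) - σ j * ψ (s j))) * ‖ξ j‖ ^ 2
      ≤ 0 := by
  have hp0 : 0 < p := by linarith
  have habs : ∀ i, |σ i| = 1 := fun i => by rcases hσ i with h | h <;> simp [h]
  have hexponent : ∀ i, |σ i * ψ (s' i) - σ i * ψ (s i)| ≤ L := fun i => by
    rw [← mul_sub, abs_mul, habs, one_mul]
    refine abs_sub_le_of_abs_deriv_le hL hψ hψL ?_
    simpa using (PiLp.norm_apply_le (s - s') i).trans hss'
  have hsum : (∑ i : Fin m, σ i / p * fderiv ℝ A s (EuclideanSpace.single i 1) *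
      Real.exp (σ i * ψ (s' i) - σ i * ψ (s i))) ≤ m * (C₀ / p * Real.exp L) := by
    have hterm : ∀ i ∈ Finset.univ, σ i / p * fderiv ℝ A s (EuclideanSpace.single i 1) *
        Real.exp (σ i * ψ (s' i) - σ i * ψ (s i)) ≤ C₀ / p * Real.exp L := fun i _ => by
      refine mul_le_mul ?_ (Real.exp_le_exp.2 (abs_le.1 (hexponent i)).2)
        (Real.exp_pos _).le (by positivity)
      rw [div_mul_eq_mul_div]
      refine div_le_div_of_nonneg_right ((le_abs_self _).trans ?_) hp0.le
      rw [abs_mul, habs, one_mul]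
      exact hA' i s
    simpa using Finset.sum_le_card_nsmul _ _ _ hterm
  refine Finset.sum_nonpos fun j _ => mul_nonpos_of_nonpos_of_nonneg ?_ (by positivity)
  have hlow : m * (C₀ / p * Real.exp L) ≤
      A s * deriv ψ (s j) * Real.exp (σ j * ψ (s' j) - σ j * ψ (s j)) := by
    have hderiv : 0 ≤ deriv ψ (s j) := le_trans (by positivity) (hψlow (s j))
    have hAs : 0 ≤ A s := hν₀.le.trans (hAν s)
    calc m * (C₀ / p * Real.exp L)
        = ν₀ * (C₀ * m / (ν₀ * p) * Real.exp (2 * L)) * Real.exp (-L) := by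
          rw [mul_assoc, mul_assoc, ← Real.exp_add, show 2 * L + -L = L by ring]
          field_simp
      _ ≤ _ := by
          refine mul_le_mul (mul_le_mul (hAν s) (hψlow _) (by positivity) hAs)
            (Real.exp_le_exp.2 (abs_le.1 (hexponent j)).1) (Real.exp_pos _).le
            (mul_nonneg hAs hderiv)
  linarith
end

section
/- Let m ≥ 1, N ≥ 1 be integers, p > 1, C₀ > 0, ν₀ > 0 be reals with C₀ m/(ν₀ p) ≤ 1/(2e). Let A : ℝᵐ → ℝ be differentiable with |∂_{s_i}A(s)| ≤ C₀ for every i = 1,…,m and every s ∈ ℝᵐ, and A(s) ≥ ν₀ for every s ∈ ℝᵐ. Then the function ψ(t) := t/2 satisfies the condition (ψ): for every choice of signs σ₁,…,σ_m ∈ {−1,1}, every s, s' ∈ ℝᵐ with ‖s − s'‖ ≤ 1, and every ξ₁,…,ξ_m ∈ ℝᴺ, one has ∑_{j=1}^m { ∑_{i=1}^m (σ_i/p) ∂_{s_i}A(s) e^{σ_i(s'_i − s_i)/2} − (A(s)/2) e^{σ_j(s'_j − s_j)/2} } ‖ξ_j‖² ≤ 0. -/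
/-- If `C₀ m/(ν₀ p) ≤ 1/(2e)`, then `ψ(t) = t/2` satisfies the structural condition (ψ):
for all signs `σᵢ ∈ {-1,1}`, all `s, s'` with `‖s - s'‖ ≤ 1` and all `ξ₁,…,ξ_m ∈ ℝᴺ`,
`∑_j { ∑_i (σᵢ/p) ∂_{s_i}A(s) e^{σᵢ(s'ᵢ-sᵢ)/2} - (A(s)/2) e^{σⱼ(s'ⱼ-sⱼ)/2} } ‖ξⱼ‖² ≤ 0`. -/
theorem psi_condition_half (m N : ℕ) (hm : 1 ≤ m) (hN : 1 ≤ N)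
    (p C₀ ν₀ : ℝ) (hp : 1 < p) (hC₀ : 0 < C₀) (hν₀ : 0 < ν₀)
    (hsmall : C₀ * m / (ν₀ * p) ≤ 1 / (2 * Real.exp 1))
    (A : EuclideanSpace ℝ (Fin m) → ℝ) (hA : Differentiable ℝ A)
    (hA' : ∀ (i : Fin m) (s : EuclideanSpace ℝ (Fin m)),
      |fderiv ℝ A s (EuclideanSpace.single i 1)| ≤ C₀)
    (hAν : ∀ s : EuclideanSpace ℝ (Fin m), ν₀ ≤ A s)
    (σ : Fin m → ℝ) (hσ : ∀ i, σ i = 1 ∨ σ i = -1)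
    (s s' : EuclideanSpace ℝ (Fin m)) (hss' : ‖s - s'‖ ≤ 1)
    (ξ : Fin m → EuclideanSpace ℝ (Fin N)) :
    ∑ j : Fin m,
      ((∑ i : Fin m, σ i / p * fderiv ℝ A s (EuclideanSpace.single i 1) *
          Real.exp (σ i * (s' i - s i) / 2))
        - A s / 2 * Real.exp (σ j * (s' j - s j) / 2)) * ‖ξ j‖ ^ 2
      ≤ 0 := by
  have hp0 : 0 < p := by linarith
  have harg : ∀ i, |σ i * (s' i - s i) / 2| ≤ 1 / 2 := fun i => by
    have hcoord : |s i - s' i| ≤ 1 := (PiLp.norm_apply_le (s - s') i).trans hss'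
    have hσi : |σ i| = 1 := by rcases hσ i with h | h <;> simp [h]
    rw [abs_div, abs_mul, hσi, abs_sub_comm, abs_two]
    linarith
  have hterm : ∀ i, σ i / p * fderiv ℝ A s (EuclideanSpace.single i 1) *
      Real.exp (σ i * (s' i - s i) / 2) ≤ C₀ / p * Real.exp (1 / 2) := fun i => by
    have hcoef : σ i / p * fderiv ℝ A s (EuclideanSpace.single i 1) ≤ C₀ / p := by
      rw [div_mul_eq_mul_div]
      gcongr
      have h := abs_le.mp (hA' i s)
      rcases hσ i with hi | hi <;> rw [hi] <;> linarith
    have hexp : Real.exp (σ i * (s' i - s i) / 2) ≤ Real.exp (1 / 2) :=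
      Real.exp_le_exp.mpr (abs_le.mp (harg i)).2
    exact mul_le_mul hcoef hexp (Real.exp_pos _).le (by positivity)
  have hsum : ∑ i, σ i / p * fderiv ℝ A s (EuclideanSpace.single i 1) *
      Real.exp (σ i * (s' i - s i) / 2) ≤ ν₀ / 2 * Real.exp (-(1 / 2)) := by
    have hexp : Real.exp (1 / 2) = Real.exp 1 * Real.exp (-(1 / 2)) := by
      rw [← Real.exp_add]
      norm_num
    calc _ ≤ ∑ _i : Fin m, C₀ / p * Real.exp (1 / 2) := Finset.sum_le_sum fun i _ => hterm i
      _ = C₀ * m / (ν₀ * p) * (ν₀ * Real.exp (1 / 2)) := by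
        rw [Finset.sum_const, Finset.card_univ, Fintype.card_fin, nsmul_eq_mul]
        field_simp
      _ ≤ 1 / (2 * Real.exp 1) * (ν₀ * Real.exp (1 / 2)) := by gcongr
      _ = ν₀ / 2 * Real.exp (-(1 / 2)) := by
        rw [hexp]
        field_simp
  refine Finset.sum_nonpos fun j _ => mul_nonpos_of_nonpos_of_nonneg ?_ (by positivity)
  have hlower : ν₀ / 2 * Real.exp (-(1 / 2)) ≤ A s / 2 * Real.exp (σ j * (s' j - s j) / 2) := by
    have hνA := hAν s
    have hA0 : 0 ≤ A s := hν₀.le.trans hνA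
    have hargj := (abs_le.mp (harg j)).1
    gcongr
  linarith
end

section
/- Let N ≥ 3 be an integer and set k := 12(N−2). Define u(x) := −k log‖x‖ for x ∈ ℝᴺ \ {0}, and A(x,s) := 1 + 1/(‖x‖^k e^s + 1) with ∂_s A(x,s) = −‖x‖^k e^s/(‖x‖^k e^s + 1)². Consider the vector field F(x) := A(x, u(x)) ∇u(x), where ∇u(x) = −k x/‖x‖². Then for every x ≠ 0: (i) ‖x‖^k e^{u(x)} = 1, so A(x,u(x)) = 3/2 and ∂_s A(x,u(x)) = −1/4, hence F(x) = −(3k/2) x/‖x‖²; (ii) F is differentiable at x with divergence div F(x) = −(3k/2)(N−2)/‖x‖²; and (iii) the pointwise identity −div F(x) + (1/2) ∂_s A(x, u(x)) ‖∇u(x)‖² = 0 holds. -/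
/-- The Fréchet derivative of the radial field `y ↦ (c / ‖y‖²) y` away from the origin. -/
theorem hasFDerivAt_div_norm_sq_smul {E : Type*} [NormedAddCommGroup E] [InnerProductSpace ℝ E]
    (c : ℝ) {x : E} (hx : x ≠ 0) :
    HasFDerivAt (fun y : E => (c / ‖y‖ ^ 2) • y)
      ((c / ‖x‖ ^ 2) • ContinuousLinearMap.id ℝ E +
        ((-(2 * c) / ‖x‖ ^ 4) • innerSL ℝ x).smulRight x) x := by
  have hn : ‖x‖ ≠ 0 := norm_ne_zero_iff.mpr hx
  have hsq : HasFDerivAt (fun y : E => ‖y‖ ^ 2) (2 • innerSL ℝ x) x :=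
    (hasStrictFDerivAt_norm_sq x).hasFDerivAt
  have hinv : HasDerivAt (fun t : ℝ => c / t) (-c / (‖x‖ ^ 2) ^ 2) (‖x‖ ^ 2) := by
    simpa [div_eq_mul_inv] using (hasDerivAt_inv (pow_ne_zero 2 hn)).const_mul c
  have hcoeff : (-(2 * c) / ‖x‖ ^ 4) • innerSL ℝ x =
      (-c / (‖x‖ ^ 2) ^ 2) • 2 • innerSL ℝ x := by
    rw [← Nat.cast_smul_eq_nsmul ℝ, smul_smul]
    congr 1
    push_cast
    ring
  rw [hcoeff]
  exact (hinv.comp_hasFDerivAt x hsq).smul (hasFDerivAt_id x)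

/-- The divergence of the radial field `y ↦ (c / ‖y‖²) y` away from the origin. -/
theorem trace_fderiv_div_norm_sq_smul {E : Type*} [NormedAddCommGroup E] [InnerProductSpace ℝ E]
    [FiniteDimensional ℝ E] (c : ℝ) {x : E} (hx : x ≠ 0) :
    LinearMap.trace ℝ E (fderiv ℝ (fun y : E => (c / ‖y‖ ^ 2) • y) x : E →ₗ[ℝ] E) =
      c * (Module.finrank ℝ E - 2) / ‖x‖ ^ 2 := by
  have hn : ‖x‖ ≠ 0 := norm_ne_zero_iff.mpr hx
  have hs : ((((-(2 * c) / ‖x‖ ^ 4) • innerSL ℝ x).smulRight x : E →L[ℝ] E) : E →ₗ[ℝ] E) =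
      LinearMap.smulRight (((-(2 * c) / ‖x‖ ^ 4) • innerSL ℝ x : E →L[ℝ] ℝ) : E →ₗ[ℝ] ℝ) x := rfl
  rw [(hasFDerivAt_div_norm_sq_smul c hx).fderiv, ContinuousLinearMap.toLinearMap_add,
    ContinuousLinearMap.toLinearMap_smul, map_add, map_smul, hs, LinearMap.trace_smulRight,
    ContinuousLinearMap.coe_id, LinearMap.trace_id]
  simp
  field_simp
  ring

/-- Computational content of the paper's singular-solution remark. With `k = 12(N-2)`,
`u(x) = -k log‖x‖`, `A(x,s) = 1 + 1/(‖x‖^k e^s + 1)` and `F(x) = A(x,u(x)) ∇u(x)` where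
`∇u(x) = -k x/‖x‖²`, for every `x ≠ 0`:
(i) `‖x‖^k e^{u(x)} = 1`, so `A(x,u(x)) = 3/2`, `∂ₛA(x,u(x)) = -1/4` and
`F(x) = -(3k/2) x/‖x‖²`;
(ii) `F` is differentiable at `x` with divergence (trace of the Fréchet derivative)
`div F(x) = -(3k/2)(N-2)/‖x‖²`;
(iii) `-div F(x) + (1/2) ∂ₛA(x,u(x)) ‖∇u(x)‖² = 0`. -/
theorem singular_solution_computation (N : ℕ) (hN : 3 ≤ N) (k : ℝ) (hk : k = 12 * (N - 2))
    (u : EuclideanSpace ℝ (Fin N) → ℝ) (hu : ∀ x, u x = -k * Real.log ‖x‖)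
    (A : EuclideanSpace ℝ (Fin N) → ℝ → ℝ)
    (hA : ∀ x s, A x s = 1 + 1 / (‖x‖ ^ k * Real.exp s + 1))
    (F : EuclideanSpace ℝ (Fin N) → EuclideanSpace ℝ (Fin N))
    (hF : ∀ x, F x = A x (u x) • ((-k / ‖x‖ ^ 2) • x))
    (x : EuclideanSpace ℝ (Fin N)) (hx : x ≠ 0) :
    (‖x‖ ^ k * Real.exp (u x) = 1 ∧ A x (u x) = 3 / 2 ∧
      deriv (A x) (u x) = -(1 / 4) ∧ F x = (-(3 * k / 2) / ‖x‖ ^ 2) • x) ∧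
    (DifferentiableAt ℝ F x ∧
      LinearMap.trace ℝ (EuclideanSpace ℝ (Fin N)) (fderiv ℝ F x : _ →ₗ[ℝ] _)
        = -(3 * k / 2) * (N - 2) / ‖x‖ ^ 2) ∧
    (-(LinearMap.trace ℝ (EuclideanSpace ℝ (Fin N)) (fderiv ℝ F x : _ →ₗ[ℝ] _))
        + (1 / 2) * deriv (A x) (u x) *
            ‖((-k / ‖x‖ ^ 2) • x : EuclideanSpace ℝ (Fin N))‖ ^ 2 = 0) := by
  have hpos : ∀ y : EuclideanSpace ℝ (Fin N), y ≠ 0 → ‖y‖ ^ k * Real.exp (u y) = 1 := by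
    intro y hy
    rw [hu, Real.rpow_def_of_pos (norm_pos_iff.mpr hy), ← Real.exp_add]
    simp [mul_comm]
  have hA' : ∀ y : EuclideanSpace ℝ (Fin N), y ≠ 0 → A y (u y) = 3 / 2 := by
    intro y hy
    rw [hA, hpos y hy]
    norm_num
  have hFeq : F = fun y => (-(3 * k / 2) / ‖y‖ ^ 2) • y := by
    funext y
    rcases eq_or_ne y 0 with rfl | hy
    · simp [hF]
    · rw [hF, hA' y hy, smul_smul]
      ring_nf
  have hderiv : deriv (A x) (u x) = -(1 / 4) := by
    have h1 : HasDerivAt (fun s => ‖x‖ ^ k * Real.exp s + 1) (‖x‖ ^ k * Real.exp (u x)) (u x) :=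
      ((Real.hasDerivAt_exp (u x)).const_mul _).add_const 1
    have h2 := (h1.fun_inv (by rw [hpos x hx]; norm_num)).const_add 1
    rw [funext (hA x)]
    simp only [one_div]
    rw [h2.deriv, hpos x hx]
    norm_num
  have hdiv : LinearMap.trace ℝ (EuclideanSpace ℝ (Fin N)) (fderiv ℝ F x : _ →ₗ[ℝ] _)
      = -(3 * k / 2) * (N - 2) / ‖x‖ ^ 2 := by
    rw [hFeq, trace_fderiv_div_norm_sq_smul _ hx, finrank_euclideanSpace_fin]
  refine ⟨⟨hpos x hx, hA' x hx, hderiv, congrFun hFeq x⟩, ⟨?_, hdiv⟩, ?_⟩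
  · rw [hFeq]
    exact (hasFDerivAt_div_norm_sq_smul _ hx).differentiableAt
  · have hn : ‖x‖ ≠ 0 := norm_ne_zero_iff.mpr hx
    rw [hdiv, hderiv, norm_smul, mul_pow, Real.norm_eq_abs, sq_abs, hk]
    field_simp
    ring
end
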